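/- Let Q be a positive definite quadratic form on ℝ^n, i.e. Q(y) = B(y, y) for a symmetric bilinear form B on ℝ^n with B(y, y) > 0 for all y ≠ 0. Then for every z ∈ ℂ^n with Im z ≠ 0 and every v ∈ ℂ^n, the Laplacian at t = 0 of the function t ↦ √(Q(Im(z + t·v))) (t ranging over ℂ) is ≥ 0. That is, z ↦ √(Q(Im z)) is plurisubharmonic on ℂ^n \ ℝ^n. -/

import Mathlib

open Complex

/-- The componentwise imaginary part of a vector in `ℂ^n`, as a vector in `ℝ^n`. -/
noncomputable def imPart {n : ℕ} (z : EuclideanSpace ℂ (Fin n)) : EuclideanSpace ℝ (Fin n) :=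
  (WithLp.equiv 2 (Fin n → ℝ)).symm fun k => (z k).im

/-- The Laplacian of `g : ℂ → ℝ` at `t`, viewing `ℂ ≅ ℝ²`: the sum of the second
derivatives in the directions `1` and `I`. -/
noncomputable def lap (g : ℂ → ℝ) (t : ℂ) : ℝ :=
  iteratedFDeriv ℝ 2 g t ![1, 1] + iteratedFDeriv ℝ 2 g t ![Complex.I, Complex.I]

theorem imPart_add_smul_smul {n : ℕ} (z v : EuclideanSpace ℂ (Fin n)) (s : ℝ) (w : ℂ) :
    imPart (z + (s • w) • v) = imPart z + s • imPart (w • v) := by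
  ext k
  simp [imPart]
  ring

theorem imPart_add_smul {n : ℕ} (z v : EuclideanSpace ℂ (Fin n)) (t : ℂ) :
    imPart (z + t • v) = imPart z + t.re • imPart v + t.im • imPart (I • v) := by
  ext k
  simp [imPart]
  ring

/-- The second derivative along a direction is the second derivative of the restriction to the
corresponding line. -/
theorem iteratedFDeriv_two_diag_eq_deriv_deriv {E : Type*} [NormedAddCommGroup E]
    [NormedSpace ℝ E] {F : E → ℝ} (hF : ContDiffAt ℝ 2 F 0) (w : E) :
    iteratedFDeriv ℝ 2 F 0 ![w, w] = deriv (deriv fun s : ℝ => F (s • w)) 0 := by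
  rw [iteratedFDeriv_two_apply]
  have hline : ∀ s : ℝ, HasDerivAt (fun s : ℝ => s • w) w s := fun s => by
    simpa using (hasDerivAt_id s).smul_const w
  have htend : Filter.Tendsto (fun s : ℝ => s • w) (nhds 0) (nhds (0 : E)) := by
    simpa using (hline 0).continuousAt.tendsto
  have hdiff : ∀ᶠ x in nhds (0 : E), DifferentiableAt ℝ F x :=
    (hF.eventually (by simp)).mono fun x hx => hx.differentiableAt (by simp)
  have hderiv : (deriv fun s : ℝ => F (s • w)) =ᶠ[nhds 0] fun s => fderiv ℝ F (s • w) w :=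
    (htend.eventually hdiff).mono fun s hs => (hs.hasFDerivAt.comp_hasDerivAt s (hline s)).deriv
  have hF' : HasFDerivAt (fderiv ℝ F) (fderiv ℝ (fderiv ℝ F) 0) ((0 : ℝ) • w) := by
    rw [zero_smul]
    exact ((hF.fderiv_right (m := 1) (by norm_num)).differentiableAt (by simp)).hasFDerivAt
  have hsecond : HasDerivAt (fun s : ℝ => fderiv ℝ F (s • w) w)
      (fderiv ℝ (fderiv ℝ F) 0 w w) 0 :=
    ((ContinuousLinearMap.apply ℝ ℝ w).hasFDerivAt.comp_hasDerivAt (0 : ℝ)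
      (hF'.comp_hasDerivAt (0 : ℝ) (hline 0)))
  rw [hderiv.deriv_eq, hsecond.deriv]
  rfl

/-- The square root of a real quadratic polynomial with nonpositive discriminant has nonnegative
second derivative at `0`. -/
theorem deriv_deriv_sqrt_quadratic_nonneg {a b c : ℝ} (ha : 0 < a) (hdisc : b ^ 2 ≤ a * c) :
    0 ≤ deriv (deriv fun s : ℝ => Real.sqrt (a + 2 * b * s + c * s ^ 2)) 0 := by
  have hq : ∀ s : ℝ, HasDerivAt (fun s : ℝ => a + 2 * b * s + c * s ^ 2)
      (2 * b + 2 * c * s) s := fun s => by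
    have := (((hasDerivAt_id s).const_mul (2 * b)).const_add a).add
      (((hasDerivAt_id s).pow 2).const_mul c)
    refine this.congr_deriv ?_
    simp
    ring
  have hpos : ∀ᶠ s in nhds (0 : ℝ), 0 < a + 2 * b * s + c * s ^ 2 :=
    (hq 0).continuousAt.eventually (lt_mem_nhds (by simpa using ha))
  have hderiv : (deriv fun s : ℝ => Real.sqrt (a + 2 * b * s + c * s ^ 2)) =ᶠ[nhds 0]
      fun s => (2 * b + 2 * c * s) / (2 * Real.sqrt (a + 2 * b * s + c * s ^ 2)) :=
    hpos.mono fun s hs => ((hq s).sqrt hs.ne').deriv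
  have hnum : HasDerivAt (fun s : ℝ => 2 * b + 2 * c * s) (2 * c) 0 := by
    simpa using ((hasDerivAt_id (0 : ℝ)).const_mul (2 * c)).const_add (2 * b)
  have hsqrt := Real.sqrt_pos.2 ha
  have hsecond := hnum.fun_div (((hq 0).sqrt (by simpa using ha.ne')).const_mul 2)
    (by simpa using hsqrt.ne')
  rw [hderiv.deriv_eq, hsecond.deriv]
  simp only [mul_zero, add_zero, ne_eq, OfNat.ofNat_ne_zero, not_false_eq_true, zero_pow]
  refine div_nonneg ?_ (sq_nonneg _)
  have hsq := Real.sq_sqrt ha.le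
  have : 2 * c * (2 * √a) - 2 * b * (2 * (2 * b / (2 * √a))) = 4 * (a * c - b ^ 2) / √a := by
    field_simp
    rw [hsq]
    ring
  rw [this]
  exact div_nonneg (by linarith) hsqrt.le

/-- If `Q(y) = B(y,y)` for a symmetric positive definite bilinear form `B` on `ℝ^n`, then
for every `z` with `Im z ≠ 0` and every `v`, the Laplacian at `t = 0` of
`t ↦ √(Q(Im (z + t • v)))` is nonnegative: `z ↦ √(Q(Im z))` is plurisubharmonic on
`ℂ^n \ ℝ^n`. -/
theorem stmt4 {n : ℕ} (B : LinearMap.BilinForm ℝ (EuclideanSpace ℝ (Fin n)))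
    (hsymm : ∀ x y, B x y = B y x)
    (hpos : ∀ y : EuclideanSpace ℝ (Fin n), y ≠ 0 → 0 < B y y)
    (z : EuclideanSpace ℂ (Fin n)) (hy : imPart z ≠ 0) (v : EuclideanSpace ℂ (Fin n)) :
    0 ≤ lap (fun t : ℂ => Real.sqrt (B (imPart (z + t • v)) (imPart (z + t • v)))) 0 := by
  have hcs : ∀ x y, B x y ^ 2 ≤ B x x * B y y := fun x y =>
    LinearMap.BilinForm.apply_sq_le_of_symm B
      (fun x => by
        rcases eq_or_ne x 0 with rfl | hx
        · simp
        · exact (hpos x hx).le) ⟨hsymm⟩ x y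
  have hquad : ∀ (w : ℂ) (s : ℝ),
      B (imPart (z + (s • w) • v)) (imPart (z + (s • w) • v)) =
        B (imPart z) (imPart z) + 2 * B (imPart z) (imPart (w • v)) * s +
          B (imPart (w • v)) (imPart (w • v)) * s ^ 2 := fun w s => by
    rw [imPart_add_smul_smul]
    simp only [map_add, map_smul, LinearMap.add_apply, LinearMap.smul_apply, smul_eq_mul]
    rw [hsymm (imPart (w • v)) (imPart z)]
    ring
  have hcont : ContDiffAt ℝ 2
      (fun t : ℂ => Real.sqrt (B (imPart (z + t • v)) (imPart (z + t • v)))) 0 := by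
    refine ContDiffAt.sqrt ?_ (by simpa using (hpos _ hy).ne')
    have hre : ContDiff ℝ 2 fun t : ℂ => t.re := reCLM.contDiff
    have him : ContDiff ℝ 2 fun t : ℂ => t.im := imCLM.contDiff
    simp only [imPart_add_smul, map_add, map_smul, LinearMap.add_apply, LinearMap.smul_apply,
      smul_eq_mul]
    fun_prop
  have hdir : ∀ w : ℂ, 0 ≤ iteratedFDeriv ℝ 2
      (fun t : ℂ => Real.sqrt (B (imPart (z + t • v)) (imPart (z + t • v)))) 0 ![w, w] := by
    intro w
    rw [iteratedFDeriv_two_diag_eq_deriv_deriv hcont]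
    simp only [hquad]
    exact deriv_deriv_sqrt_quadratic_nonneg (hpos _ hy) (hcs _ _)
  exact add_nonneg (hdir 1) (hdir I)
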